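/- arXiv:math/0204132 — 2 statements merged into one kernel-verified Lean document; each statement's English description precedes it below -/
import Mathlib

section
/- Let (X,τ) be a topological space, let C be a compact saturated subset of (X,τ), let ψ be a family of compact saturated subsets of (X,τ^d), and let M ∈ ψ. If the family {C} ∪ ψ has the finite intersection property, then there exists a point ξ ∈ M such that the family {C} ∪ ψ ∪ {cl_τ{ξ}} also has the finite intersection property. -/
/-- A set is *saturated* in a topological space if it is an intersection of open sets. -/
def IsSaturatedSet {X : Type*} (t : TopologicalSpace X) (A : Set X) : Prop :=
  ∃ S : Set (Set X), (∀ U ∈ S, t.IsOpen U) ∧ A = ⋂₀ S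

/-- The de Groot dual of a topology: the topology generated by taking the compact
saturated sets as a closed base (equivalently, their complements as an open subbase). -/
def deGrootDual {X : Type*} (t : TopologicalSpace X) : TopologicalSpace X :=
  TopologicalSpace.generateFrom
    {U : Set X | ∃ K : Set X, @IsCompact X t K ∧ IsSaturatedSet t K ∧ U = Kᶜ}

/-- A family of sets has the finite intersection property if every finite
subfamily has nonempty intersection. -/
def HasFIP {X : Type*} (F : Set (Set X)) : Prop :=
  ∀ G : Finset (Set X), ↑G ⊆ F → (⋂₀ (G : Set (Set X))).Nonempty


theorem dual_isClosed {X : Type*} [t : TopologicalSpace X] {K : Set X}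
    (h1 : IsCompact K) (h2 : IsSaturatedSet t K) : @IsClosed X (deGrootDual t) K := by
  refine @IsClosed.mk X (deGrootDual t) K ?_
  exact TopologicalSpace.isOpen_generateFrom_of_mem ⟨K, h1, h2, rfl⟩

theorem saturated_nhdsKer {X : Type*} [t : TopologicalSpace X] (S : Set X) :
    IsSaturatedSet t (nhdsKer S) := by
  refine ⟨{U | IsOpen U ∧ S ⊆ U}, fun U hU => hU.1, ?_⟩
  rw [nhdsKer_def]

theorem saturated_up {X : Type*} [t : TopologicalSpace X] {K : Set X}
    (h : IsSaturatedSet t K) {x y : X} (hx : x ∈ K) (hxy : x ∈ closure ({y} : Set X)) :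
    y ∈ K := by
  obtain ⟨S, hS, rfl⟩ := h
  intro U hU
  obtain ⟨z, hz, hz'⟩ := mem_closure_iff.1 hxy U (hS U hU) (hx U hU)
  rw [Set.mem_singleton_iff] at hz'
  exact hz' ▸ hz

theorem mem_nhdsKer_cl {X : Type*} [t : TopologicalSpace X] {S : Set X} {x : X} :
    x ∈ nhdsKer S ↔ ∃ y ∈ S, y ∈ closure ({x} : Set X) := by
  rw [mem_nhdsKer_iff_specializes]
  simp only [specializes_iff_mem_closure]

theorem dual_down {X : Type*} [t : TopologicalSpace X] {P : Set X}
    (h : IsSaturatedSet (deGrootDual t) P) {x y : X} (hy : y ∈ P)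
    (hxy : x ∈ closure ({y} : Set X)) : x ∈ P := by
  obtain ⟨S, hS, rfl⟩ := h
  intro U hU
  by_contra hx
  have hyU := hy U hU
  have hc : @IsClosed X (deGrootDual t) (nhdsKer {x}) :=
    dual_isClosed isCompact_singleton.nhdsKer (saturated_nhdsKer _)
  have key : ∀ V : Set X, (deGrootDual t).IsOpen V → y ∈ V → x ∈ V := by
    intro V hV
    induction hV with
    | basic V hV =>
      obtain ⟨K, -, hK, rfl⟩ := hV
      exact fun hy hx => hy (saturated_up hK hx hxy)
    | univ => exact fun _ => trivial
    | inter A B _ _ hA hB => exact fun h => ⟨hA h.1, hB h.2⟩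
    | sUnion T _ ih => exact fun ⟨A, hA, h⟩ => ⟨A, hA, ih A hA h⟩
  exact hx (key U (hS U hU) hyU)

theorem compact_inter {X : Type*} [t : TopologicalSpace X] {C P : Set X}
    (hC : IsCompact C)
    (hP : @IsCompact X (deGrootDual t) P) (hP2 : IsSaturatedSet (deGrootDual t) P) :
    IsCompact (C ∩ P) := by
  rw [isCompact_iff_ultrafilter_le_nhds]
  intro f hf
  rw [Filter.le_principal_iff] at hf
  obtain ⟨ξ, hξ, hfξ⟩ := (@isCompact_iff_ultrafilter_le_nhds X (deGrootDual t) P).1 hP f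
    (Filter.le_principal_iff.2 (Filter.mem_of_superset hf Set.inter_subset_right))
  have h1 : ∀ A : Set X, IsClosed A → A ∈ f → ((C ∩ closure {ξ}) ∩ A).Nonempty := by
    intro A hA hAf
    have hc : @IsClosed X (deGrootDual t) (nhdsKer (C ∩ A)) :=
      dual_isClosed (hC.inter_right hA).nhdsKer (saturated_nhdsKer _)
    have hm : nhdsKer (C ∩ A) ∈ f := by
      filter_upwards [hf, hAf] with x hx hx'
      exact subset_nhdsKer ⟨hx.1, hx'⟩
    have hξm : ξ ∈ nhdsKer (C ∩ A) := by
      by_contra hn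
      have : (nhdsKer (C ∩ A))ᶜ ∈ f :=
        hfξ (@IsOpen.mem_nhds X (deGrootDual t) ξ _ (@IsClosed.isOpen_compl X (deGrootDual t) _ hc) hn)
      exact Ultrafilter.compl_mem_iff_notMem.1 this hm
    obtain ⟨y, hy, hy'⟩ := mem_nhdsKer_cl.1 hξm
    exact ⟨y, ⟨hy.1, hy'⟩, hy.2⟩
  obtain ⟨c, ⟨hcC, hcξ⟩, hc⟩ := (hC.inter_right (isClosed_closure (s := {ξ}))).inter_iInter_nonempty
    (fun A : {A : Set X // IsClosed A ∧ A ∈ f} => A.1) (fun A => A.2.1) (by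
      intro u
      exact h1 _ (isClosed_biInter fun A _ => A.2.1)
        ((Filter.biInter_finset_mem u).2 fun A _ => A.2.2))
  refine ⟨c, ⟨hcC, dual_down hP2 hξ hcξ⟩, ?_⟩
  intro N hN
  obtain ⟨U, hUN, hU, hcU⟩ := mem_nhds_iff.1 hN
  refine Filter.mem_of_superset ?_ hUN
  by_contra hn
  have := Set.mem_iInter.1 hc ⟨Uᶜ, hU.isClosed_compl, Ultrafilter.compl_mem_iff_notMem.2 hn⟩
  exact this hcU

theorem compact_fin {X : Type*} [t : TopologicalSpace X] {C : Set X} {ψ : Set (Set X)}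
    (hC₁ : IsCompact C) 
    (hψ : ∀ P ∈ ψ, @IsCompact X (deGrootDual t) P ∧ IsSaturatedSet (deGrootDual t) P)
    (G : Finset (Set X)) (hG : ↑G ⊆ ψ) : IsCompact (C ∩ ⋂₀ (G : Set (Set X))) := by
  classical
  induction G using Finset.induction_on with
  | empty => simpa using hC₁
  | insert P G _ ih =>
    rw [Finset.coe_insert, Set.insert_subset_iff] at hG
    have := compact_inter (ih hG.2) (hψ P hG.1).1 (hψ P hG.1).2
    rw [Finset.coe_insert, Set.sInter_insert]
    convert this using 1
    ext x
    simp only [Set.mem_inter_iff]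
    tauto

theorem exists_point_fip {X : Type*} [t : TopologicalSpace X] (C M : Set X) (ψ : Set (Set X))
    (hC₁ : IsCompact C) (hC₂ : IsSaturatedSet t C)
    (hψ : ∀ P ∈ ψ, @IsCompact X (deGrootDual t) P ∧ IsSaturatedSet (deGrootDual t) P)
    (hM : M ∈ ψ)
    (hfip : HasFIP ({C} ∪ ψ)) :
    ∃ ξ ∈ M, HasFIP ({C} ∪ ψ ∪ {closure ({ξ} : Set X)}) := by
  classical
  obtain ⟨ξ, hξM, hξ⟩ := @IsCompact.inter_iInter_nonempty X (deGrootDual t) M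
    {G : Finset (Set X) // ↑G ⊆ ψ} (hψ M hM).1
    (fun G => nhdsKer (C ∩ ⋂₀ (G.1 : Set (Set X))))
    (fun G => dual_isClosed (compact_fin hC₁ hψ G.1 G.2).nhdsKer (saturated_nhdsKer _)) (by
      intro u
      obtain ⟨x, hx⟩ := hfip (insert C (insert M (u.biUnion fun G => G.1))) (by
        intro P hP
        simp only [Finset.coe_insert, Set.mem_insert_iff, Finset.mem_coe,
          Finset.mem_biUnion] at hP
        rcases hP with rfl | rfl | ⟨G, _, hP⟩
        · exact Or.inl rfl
        · exact Or.inr hM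
        · exact Or.inr (G.2 hP))
      refine ⟨x, hx M (by simp), Set.mem_iInter₂.2 fun G hG => subset_nhdsKer
        ⟨hx C (by simp), fun P hP => hx P ?_⟩⟩
      simp only [Finset.coe_insert, Set.mem_insert_iff, Finset.mem_coe, Finset.mem_biUnion]
      exact Or.inr (Or.inr ⟨G, hG, hP⟩))
  refine ⟨ξ, hξM, fun G hG => ?_⟩
  have := Set.mem_iInter.1 hξ ⟨G.filter (· ∈ ψ), fun P hP => by simpa using (Finset.mem_filter.1 hP).2⟩
  obtain ⟨y, ⟨hyC, hy⟩, hy'⟩ := mem_nhdsKer_cl.1 this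
  refine ⟨y, fun P hP => ?_⟩
  rcases hG hP with (h | h) | h
  · rw [Set.mem_singleton_iff] at h
    exact h ▸ hyC
  · exact hy P (by simpa using ⟨hP, h⟩)
  · rw [Set.mem_singleton_iff] at h
    exact h ▸ hy'
end

section
/- For any topological space (X,τ): if τ^{ddd} = τ, then τ^{ddd} = τ^d. (This gives the inclusion G_{3a} ⊆ G_{3b}, which yields G_3 = G_{3b} ∪ G_{3c} in the paper's notation.) -/
/-- Specialization preorder. -/
def sple {X : Type*} (t : TopologicalSpace X) (x y : X) : Prop :=
  ∀ U, t.IsOpen U → x ∈ U → y ∈ U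

theorem sat_iff {X : Type*} (t : TopologicalSpace X) (A : Set X) :
    IsSaturatedSet t A ↔ ∀ x y, sple t x y → x ∈ A → y ∈ A := by
  constructor
  · rintro ⟨S, hS, rfl⟩ x y hxy hx U hU
    exact hxy U (hS U hU) (hx U hU)
  · intro h
    refine ⟨{U | t.IsOpen U ∧ A ⊆ U}, fun U hU => hU.1, ?_⟩
    apply Set.Subset.antisymm
    · intro x hx U hU
      exact hU.2 hx
    · intro y hy
      by_contra hyA
      have key : ∀ x ∈ A, ∃ U, t.IsOpen U ∧ x ∈ U ∧ y ∉ U := by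
        intro x hx
        by_contra hc
        push Not at hc
        exact hyA (h x y hc hx)
      choose! f hf using key
      have ho : t.IsOpen (⋃₀ (f '' A)) := t.isOpen_sUnion _ (by
        rintro _ ⟨x, hx, rfl⟩
        exact (hf x hx).1)
      have := hy _ ⟨ho, fun x hx => ⟨f x, ⟨x, hx, rfl⟩, (hf x hx).2.1⟩⟩
      obtain ⟨_, ⟨x, hx, rfl⟩, hyx⟩ := this
      exact (hf x hx).2.2 hyx

theorem dual_closed {X : Type*} (t : TopologicalSpace X) (K : Set X)
    (hK : @IsCompact X t K) (hs : IsSaturatedSet t K) :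
    @IsClosed X (deGrootDual t) K :=
  @IsClosed.mk X (deGrootDual t) K (TopologicalSpace.GenerateOpen.basic _ ⟨K, hK, hs, rfl⟩)

theorem sple_dual {X : Type*} (t : TopologicalSpace X) (x y : X) :
    sple (deGrootDual t) x y ↔ sple t y x := by
  constructor
  · intro h
    by_contra hc
    have hcomp : @IsCompact X t {z | sple t y z} := by
      letI := t
      apply isCompact_of_finite_subcover
      intro ι U hU hc
      obtain ⟨i, hi⟩ := Set.mem_iUnion.1 (hc (show sple t y y from fun _ _ h => h))
      refine ⟨{i}, fun z hz => ?_⟩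
      simpa using hz _ (hU i) hi
    have hsat : IsSaturatedSet t {z | sple t y z} :=
      (sat_iff t _).2 fun a b hab ha U hU hy => hab U hU (ha U hU hy)
    exact h _ (TopologicalSpace.GenerateOpen.basic _ ⟨_, hcomp, hsat, rfl⟩) hc
      (fun _ _ h => h)
  · intro h U hU
    change TopologicalSpace.GenerateOpen _ U at hU
    induction hU with
    | basic s hs =>
      obtain ⟨K, _, hs, rfl⟩ := hs
      exact fun hx hy => hx ((sat_iff t K).1 hs _ _ h hy)
    | univ => exact fun _ => trivial
    | inter s u _ _ h1 h2 => exact fun hx => ⟨h1 hx.1, h2 hx.2⟩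
    | sUnion S _ ih => exact fun ⟨s, hs, hx⟩ => ⟨s, hs, ih s hs hx⟩

theorem sat_dual {X : Type*} (t : TopologicalSpace X)
    (hsym : ∀ x y, sple t x y → sple t y x) (A : Set X) :
    IsSaturatedSet (deGrootDual t) A ↔ IsSaturatedSet t A := by
  simp only [sat_iff, sple_dual]
  exact ⟨fun h x y hxy => h x y (hsym _ _ hxy), fun h x y hxy => h x y (hsym _ _ hxy)⟩

/-- A compact set of the dual meets a compact saturated set in a compact set. -/
theorem inter_compact {X : Type*} (t : TopologicalSpace X)
    (hsym : ∀ x y, sple t x y → sple t y x) (L M : Set X)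
    (hL : @IsCompact X t L) (hLs : IsSaturatedSet t L)
    (hM : @IsCompact X (deGrootDual t) M) : @IsCompact X t (M ∩ L) := by
  have hML : @IsCompact X (deGrootDual t) (M ∩ L) :=
    @IsCompact.inter_right X (deGrootDual t) _ _ hM (dual_closed t L hL hLs)
  refine @isCompact_of_finite_subcover X t _ ?_
  intro ι U hU hc
  have hcl : ∀ i, @IsClosed X (deGrootDual t) (L ∩ (U i)ᶜ) := fun i => by
    apply dual_closed
    · exact @IsCompact.inter_right X t _ _ hL (@IsOpen.isClosed_compl X t _ (hU i))
    · rw [sat_iff] at hLs ⊢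
      exact fun x y hxy hx => ⟨hLs x y hxy hx.1, fun hy => hx.2 (hsym x y hxy _ (hU i) hy)⟩
  obtain ⟨s, hs⟩ := @IsCompact.elim_finite_subcover X (deGrootDual t) _ ι hML
    (fun i => (L ∩ (U i)ᶜ)ᶜ) (fun i => @IsClosed.isOpen_compl X (deGrootDual t) _ (hcl i)) (by
      intro x hx
      obtain ⟨i, hi⟩ := Set.mem_iUnion.1 (hc hx)
      exact Set.mem_iUnion.2 ⟨i, fun h => h.2 hi⟩)
  refine ⟨s, fun x hx => ?_⟩
  have := hs hx
  simp only [Set.mem_iUnion] at this ⊢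
  obtain ⟨i, hi, hx'⟩ := this
  exact ⟨i, hi, by_contra fun h => hx' ⟨hx.2, h⟩⟩

theorem compact_dd {X : Type*} (t : TopologicalSpace X)
    (hsym : ∀ x y, sple t x y → sple t y x) (L : Set X)
    (hL : @IsCompact X t L) (hLs : IsSaturatedSet t L) :
    @IsCompact X (deGrootDual (deGrootDual t)) L := by
  refine @isCompact_generateFrom X (deGrootDual (deGrootDual t)) _ rfl L ?_
  intro P hP hc
  rcases P.eq_empty_or_nonempty with rfl | ⟨V, hV⟩
  · exact ⟨∅, Set.Subset.rfl, Set.finite_empty, hc⟩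
  obtain ⟨M₀, hM₀, _, rfl⟩ := hP hV
  have hML : @IsCompact X (deGrootDual t) (M₀ ∩ L) :=
    @IsCompact.inter_right X (deGrootDual t) _ _ hM₀ (dual_closed t L hL hLs)
  have hcl : ∀ W : P, @IsClosed X (deGrootDual t) ((W : Set X)ᶜ ∩ L) := fun W => by
    obtain ⟨M, hM, hMs, hW⟩ := hP W.2
    rw [hW, compl_compl]
    apply dual_closed
    · exact inter_compact t hsym L M hL hLs hM
    · rw [sat_dual t hsym] at hMs
      rw [sat_iff] at hLs hMs ⊢
      exact fun x y hxy hx => ⟨hMs x y hxy hx.1, hLs x y hxy hx.2⟩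
  obtain ⟨s, hs⟩ := @IsCompact.elim_finite_subcover X (deGrootDual t) _ P hML
    (fun W => ((W : Set X)ᶜ ∩ L)ᶜ)
    (fun i => @IsClosed.isOpen_compl X (deGrootDual t) _ (hcl i)) (by
      intro x hx
      obtain ⟨W, hW, hxW⟩ := hc hx.2
      exact Set.mem_iUnion.2 ⟨⟨W, hW⟩, fun h => h.1 hxW⟩)
  refine ⟨insert M₀ᶜ (Subtype.val '' (s : Set P)), ?_, ?_, ?_⟩
  · rintro _ (rfl | ⟨W, _, rfl⟩)
    · exact hV
    · exact W.2
  · exact (s.finite_toSet.image _).insert _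
  · intro x hx
    by_cases hxM : x ∈ M₀
    · have := hs ⟨hxM, hx⟩
      simp only [Set.mem_iUnion] at this
      obtain ⟨W, hW, hx'⟩ := this
      exact ⟨W, Or.inr ⟨W, hW, rfl⟩, by_contra fun h => hx' ⟨h, hx⟩⟩
    · exact ⟨_, Or.inl rfl, hxM⟩

/-- G_{3a} ⊆ G_{3b}: if τ^{ddd} = τ then τ^{ddd} = τ^d. -/
theorem G3a_subset_G3b {X : Type*} (t : TopologicalSpace X)
    (h : deGrootDual (deGrootDual (deGrootDual t)) = t) :
    deGrootDual (deGrootDual (deGrootDual t)) = deGrootDual t := by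
  have hsym : ∀ x y, sple t x y → sple t y x := by
    intro x y hxy
    rw [← h] at hxy
    simpa only [sple_dual] using hxy
  have hsym1 : ∀ x y, sple (deGrootDual t) x y → sple (deGrootDual t) y x := by
    intro x y
    simp only [sple_dual]
    exact hsym y x
  have hsym2 : ∀ x y, sple (deGrootDual (deGrootDual t)) x y →
      sple (deGrootDual (deGrootDual t)) y x := by
    intro x y
    simp only [sple_dual]
    exact hsym x y
  have hs1 := sat_dual t hsym
  have hs2 := sat_dual _ hsym1
  have e : deGrootDual t = deGrootDual (deGrootDual t) := by
    conv_lhs => unfold deGrootDual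
    conv_rhs => unfold deGrootDual
    congr 1
    ext U
    refine exists_congr fun K => ?_
    constructor
    · rintro ⟨hK, hKs, rfl⟩
      refine ⟨?_, (hs1 K).2 hKs, rfl⟩
      have h1 := compact_dd t hsym K hK hKs
      have h2 := compact_dd _ hsym2 K h1 ((hs2 K).2 ((hs1 K).2 hKs))
      rwa [h] at h2
    · rintro ⟨hK, hKs, rfl⟩
      refine ⟨?_, (hs1 K).1 hKs, rfl⟩
      have h1 := compact_dd _ hsym1 K hK hKs
      rwa [h] at h1
  rw [← e, ← e]
end
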